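/- Assume Conditions (a) and (b) hold and that p_1 > 0. Then, as n → ∞, (1/n)·log( (ℓ_n − 1)!! / |𝒮_{n(n)}| ) → 0, where n(n) = (n_i(n))_{i≥1} is the type sequence of d(n); equivalently, |𝒞_{n(n)}| = e^{o(n)}·|𝒮_{n(n)}|. -/

import Mathlib

namespace PaperCM

noncomputable section

/-- Number of vertices of a type sequence. -/
def numV (m : ℕ →₀ ℕ) : ℕ := m.sum fun _ c => c

/-- Total degree of a type sequence. -/
def totalDeg (m : ℕ →₀ ℕ) : ℕ := m.sum fun i c => i * c

/-- The nondecreasing degree sequence associated with a type sequence: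
`degOf m i` is the least `j` with `m 1 + ⋯ + m j ≥ i + 1` (vertices `0`-indexed). -/
def degOf (m : ℕ →₀ ℕ) (i : ℕ) : ℕ :=
  sInf {j : ℕ | i < ∑ k ∈ Finset.Icc 1 j, m k}

/-- The half-edges of a type sequence: pairs `(v, j)` with `j < d_v`. -/
abbrev HalfEdges (m : ℕ →₀ ℕ) := Σ v : Fin (numV m), Fin (degOf m (v : ℕ))

/-- A configuration: a perfect matching of the half-edges, encoded as a
fixed-point free involution. -/
def IsConfig (m : ℕ →₀ ℕ) (f : HalfEdges m → HalfEdges m) : Prop :=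
  Function.Involutive f ∧ ∀ x, f x ≠ x

/-- Adjacency in the multigraph induced by a configuration. -/
def adj (m : ℕ →₀ ℕ) (f : HalfEdges m → HalfEdges m) (u v : Fin (numV m)) : Prop :=
  ∃ (j : Fin (degOf m (u : ℕ))) (j' : Fin (degOf m (v : ℕ))), f ⟨u, j⟩ = ⟨v, j'⟩

/-- The multigraph of the configuration is connected. -/
def IsConn (m : ℕ →₀ ℕ) (f : HalfEdges m → HalfEdges m) : Prop :=
  ∀ u v : Fin (numV m), Relation.ReflTransGen (adj m f) u v

/-- The configuration is simple: no self-loops and no multiple edges. -/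
def IsSimple (m : ℕ →₀ ℕ) (f : HalfEdges m → HalfEdges m) : Prop :=
  (∀ x : HalfEdges m, (f x).1 ≠ x.1) ∧
    ∀ x y : HalfEdges m, x.1 = y.1 → (f x).1 = (f y).1 → x = y ∨ x = f y

/-- The vertex set of the component of `v`. -/
def component (m : ℕ →₀ ℕ) (f : HalfEdges m → HalfEdges m) (v : Fin (numV m)) :
    Set (Fin (numV m)) :=
  {u | Relation.ReflTransGen (adj m f) v u}

/-- The type of the component of `v`: the number of its vertices of each degree. -/
def compType (m : ℕ →₀ ℕ) (f : HalfEdges m → HalfEdges m) (v : Fin (numV m)) (i : ℕ) : ℕ :=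
  Set.ncard {u : Fin (numV m) | u ∈ component m f v ∧ degOf m (u : ℕ) = i}

/-- The configuration has a component with type `m'`. -/
def HasCompOfType (m : ℕ →₀ ℕ) (f : HalfEdges m → HalfEdges m) (m' : ℕ →₀ ℕ) : Prop :=
  ∃ v : Fin (numV m), ∀ i, compType m f v i = m' i

/-- `v` is the minimal representative of its component. -/
def IsRep (m : ℕ →₀ ℕ) (f : HalfEdges m → HalfEdges m) (v : Fin (numV m)) : Prop :=
  ∀ u ∈ component m f v, v ≤ u

/-- Number of components of the configuration whose type lies in `𝒩`. -/
def numCompIn (m : ℕ →₀ ℕ) (f : HalfEdges m → HalfEdges m) (𝒩 : Set (ℕ →₀ ℕ)) : ℕ :=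
  Set.ncard {v : Fin (numV m) | IsRep m f v ∧ ∃ m' ∈ 𝒩, ∀ i, compType m f v i = m' i}

/-- `|𝒞_m|`: the number of configurations with type `m`. -/
def cC (m : ℕ →₀ ℕ) : ℕ := Set.ncard {f | IsConfig m f}
/-- `|𝒞c_m|`: the number of connected configurations with type `m`. -/
def cCc (m : ℕ →₀ ℕ) : ℕ := Set.ncard {f | IsConfig m f ∧ IsConn m f}
/-- `|𝒮_m|`: the number of simple configurations with type `m`. -/
def cS (m : ℕ →₀ ℕ) : ℕ := Set.ncard {f | IsConfig m f ∧ IsSimple m f}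
/-- `|𝒮c_m|`: the number of connected simple configurations with type `m`. -/
def cSc (m : ℕ →₀ ℕ) : ℕ := Set.ncard {f | IsConfig m f ∧ IsSimple m f ∧ IsConn m f}
/-- `|𝒞_m^{m'}|`: configurations with type `m` having a component of type `m'`. -/
def cCcomp (m m' : ℕ →₀ ℕ) : ℕ := Set.ncard {f | IsConfig m f ∧ HasCompOfType m f m'}
/-- `|𝒮_m^{m'}|`. -/
def cScomp (m m' : ℕ →₀ ℕ) : ℕ :=
  Set.ncard {f | IsConfig m f ∧ IsSimple m f ∧ HasCompOfType m f m'}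
/-- `|𝒞_m^{𝒩}|`: configurations with type `m` having a component whose type lies in `𝒩`. -/
def cCcompSet (m : ℕ →₀ ℕ) (𝒩 : Set (ℕ →₀ ℕ)) : ℕ :=
  Set.ncard {f | IsConfig m f ∧ ∃ m' ∈ 𝒩, HasCompOfType m f m'}
/-- `|𝒮_m^{𝒩}|`. -/
def cScompSet (m : ℕ →₀ ℕ) (𝒩 : Set (ℕ →₀ ℕ)) : ℕ :=
  Set.ncard {f | IsConfig m f ∧ IsSimple m f ∧ ∃ m' ∈ 𝒩, HasCompOfType m f m'}

/-- The type sequence `n(n) = (n_i(n))_{i ≥ 1}` of the degree sequence `d(n)`. -/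
def typeOf (d : (n : ℕ) → Fin n → ℕ) (n : ℕ) : ℕ →₀ ℕ :=
  ∑ j : Fin n, Finsupp.single (d n j) 1

/-- The total degree `ℓ_n = Σ_i i·n_i = Σ_j d_j(n)`. -/
def ℓTot (d : (n : ℕ) → Fin n → ℕ) (n : ℕ) : ℕ := ∑ j : Fin n, d n j

/-- The set `𝒩^ε(n)` of type sequences approximating `n` from below. -/
def Neps (ε : ℝ) (nn : ℕ →₀ ℕ) : Set (ℕ →₀ ℕ) :=
  {m | m ≤ nn ∧ (1 - ε) * (totalDeg nn : ℝ) < (totalDeg m : ℝ)}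

/-- `β(p)`: the solution in `(0,1)` of the fixed-point equation
`Σ_k k p_k = (1-β²) Σ_k k p_k/(1-β^k)`. -/
def betaOf (p : ℕ → ℝ) : ℝ :=
  sInf {β : ℝ | β ∈ Set.Ioo 0 1 ∧
    ∑' k : ℕ, (k : ℝ) * p k = (1 - β ^ 2) * ∑' k : ℕ, (k : ℝ) * p k / (1 - β ^ k)}

/-- The exponential rate `K(p)`. -/
def Kof (p : ℕ → ℝ) : ℝ :=
  (∑' k : ℕ, (k : ℝ) * p k) / 2 * Real.log (1 - betaOf p ^ 2)
    - ∑' k : ℕ, p k * Real.log (1 - betaOf p ^ k)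

end

end PaperCM

namespace PaperCM

section PartialMatchings

open Finset Classical

variable {X V : Type*}

/-- A partial simple matching of the half-edges `X`, encoded as an involution whose fixed points
are the unmatched half-edges; `v x` is the vertex of the half-edge `x`. -/
def IsPartialSimple (v : X → V) (g : X → X) : Prop :=
  Function.Involutive g ∧ (∀ x, g x ≠ x → v (g x) ≠ v x) ∧
    ∀ x y, g x ≠ x → g y ≠ y → v x = v y → v (g x) = v (g y) → x = y

/-- Match the half-edges `a` and `b`. -/
noncomputable def joinPair (g : X → X) (a b : X) (x : X) : X :=
  if x = a then b else if x = b then a else g x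

lemma joinPair_involutive {g : X → X} (hg : Function.Involutive g) {a b : X}
    (ha : g a = a) (hb : g b = b) : Function.Involutive (joinPair g a b) := by
  intro x
  have h1 := hg x
  have h2 : g x = a → x = a := fun h => by rw [← h1, h, ha]
  have h3 : g x = b → x = b := fun h => by rw [← h1, h, hb]
  unfold joinPair
  grind

lemma isPartialSimple_joinPair {v : X → V} {g : X → X} (hg : IsPartialSimple v g) {a b : X}
    (ha : g a = a) (hb : g b = b) (hv : v b ≠ v a)
    (hadj : ∀ x, g x ≠ x → v x = v a → v (g x) ≠ v b) :
    IsPartialSimple v (joinPair g a b) := by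
  obtain ⟨h1, h2, h3⟩ := hg
  have hadj' : ∀ x, g x ≠ x → v x = v b → v (g x) ≠ v a := by
    intro x hx hxb hxa
    refine hadj (g x) ?_ hxa ?_
    · rw [h1 x]; exact hx.symm
    · rw [h1 x]; exact hxb
  refine ⟨joinPair_involutive h1 ha hb, ?_, ?_⟩
  · intro x
    unfold joinPair
    grind
  · intro x y
    unfold joinPair
    grind

lemma joinPair_apply_left (g : X → X) (a b : X) : joinPair g a b a = b := by simp [joinPair]

variable [Fintype X]

/-- The unmatched half-edges of a partial matching. -/
noncomputable def unmatched (g : X → X) : Finset X := univ.filter fun x => g x = x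

/-- The perfect matchings extending a partial matching. -/
noncomputable def extensions (g : X → X) : Finset (X → X) :=
  univ.filter fun f => Function.Involutive f ∧ (∀ x, f x ≠ x) ∧ ∀ x, g x ≠ x → f x = g x

/-- The simple perfect matchings extending a partial matching. -/
noncomputable def simpleExtensions (v : X → V) (g : X → X) : Finset (X → X) :=
  univ.filter fun f => IsPartialSimple v f ∧ (∀ x, f x ≠ x) ∧ ∀ x, g x ≠ x → f x = g x

lemma mem_extensions {g f : X → X} : f ∈ extensions g ↔
    Function.Involutive f ∧ (∀ x, f x ≠ x) ∧ ∀ x, g x ≠ x → f x = g x := by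
  simp [extensions]

lemma mem_simpleExtensions {v : X → V} {g f : X → X} : f ∈ simpleExtensions v g ↔
    IsPartialSimple v f ∧ (∀ x, f x ≠ x) ∧ ∀ x, g x ≠ x → f x = g x := by
  simp [simpleExtensions]

lemma mem_unmatched {g : X → X} {x : X} : x ∈ unmatched g ↔ g x = x := by simp [unmatched]

lemma unmatched_joinPair {g : X → X} {a b : X} (hab : a ≠ b) :
    unmatched (joinPair g a b) = unmatched g \ {a, b} := by
  ext x
  simp only [mem_unmatched, joinPair, mem_sdiff, mem_insert, mem_singleton]
  grind

lemma card_mul_le_simpleExtensions {v : X → V} {g : X → X} {a : X} {B : Finset X} {m : ℕ}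
    (ha : g a = a) (haB : a ∉ B) (hB : B ⊆ unmatched g)
    (h : ∀ b ∈ B, m ≤ #(simpleExtensions v (joinPair g a b))) :
    #B * m ≤ #(simpleExtensions v g) := by
  have hval : ∀ b ∈ B, ∀ f ∈ simpleExtensions v (joinPair g a b), f a = b := by
    intro b hb f hf
    have hne : b ≠ a := fun h => haB (h ▸ hb)
    have := (mem_simpleExtensions.1 hf).2.2 a (by rw [joinPair_apply_left]; exact hne)
    rw [this, joinPair_apply_left]
  calc #B * m ≤ ∑ b ∈ B, #(simpleExtensions v (joinPair g a b)) := by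
        simpa using card_nsmul_le_sum B _ m h
    _ = #(B.biUnion fun b => simpleExtensions v (joinPair g a b)) := by
        refine (card_biUnion ?_).symm
        intro b hb b' hb' hne
        refine disjoint_left.2 fun f hf hf' => hne ?_
        rw [← hval b hb f hf, hval b' hb' f hf']
    _ ≤ _ := by
        refine card_le_card fun f hf => ?_
        obtain ⟨b, hb, hf⟩ := mem_biUnion.1 hf
        obtain ⟨h1, h2, h3⟩ := mem_simpleExtensions.1 hf
        refine mem_simpleExtensions.2 ⟨h1, h2, fun x hx => ?_⟩
        have hxa : x ≠ a := fun h => hx (h ▸ ha)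
        have hxb : x ≠ b := fun h => hx (h ▸ mem_unmatched.1 (hB hb))
        have hj : joinPair g a b x = g x := by simp [joinPair, hxa, hxb]
        rw [h3 x (by rwa [hj]), hj]

/-- Matching all of `A` into a set `B` of half-edges of leaves. -/
lemma descFactorial_mul_le_simpleExtensions {v : X → V} {m : ℕ} (k : ℕ) :
    ∀ (g : X → X) (A B : Finset X), #A = k → IsPartialSimple v g → A ⊆ unmatched g →
      B ⊆ unmatched g → Disjoint A B → (∀ b ∈ B, ∀ x, v x = v b → x = b) →
      (∀ g', IsPartialSimple v g' → ∀ B' ⊆ B, #B' = k → unmatched g' = unmatched g \ (A ∪ B') →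
        m ≤ #(simpleExtensions v g')) →
      (#B).descFactorial k * m ≤ #(simpleExtensions v g) := by
  induction k with
  | zero =>
    intro g A B hA hg _ _ _ _ h
    obtain rfl := card_eq_zero.1 hA
    simpa using h g hg ∅ (empty_subset _) rfl (by simp)
  | succ k ih =>
    intro g A B hA hg hAu hBu hAB hleaf h
    obtain ⟨a, ha⟩ : A.Nonempty := card_pos.1 (by omega)
    have haB : a ∉ B := disjoint_left.1 hAB ha
    have hga := mem_unmatched.1 (hAu ha)
    rcases hn : #B with _ | n
    · simp
    rw [Nat.succ_descFactorial_succ, ← hn, mul_assoc]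
    refine card_mul_le_simpleExtensions hga haB hBu fun b hb => ?_
    have hab : a ≠ b := fun h => haB (h ▸ hb)
    have hgb := mem_unmatched.1 (hBu hb)
    have hn' : #(B.erase b) = n := by rw [card_erase_of_mem hb, hn]; rfl
    rw [← hn']
    refine ih _ (A.erase a) (B.erase b) (by rw [card_erase_of_mem ha, hA]; rfl) ?_ ?_ ?_ ?_ ?_ ?_
    · refine isPartialSimple_joinPair hg hga hgb (fun h => hab (hleaf b hb a h.symm)) ?_
      intro x hx _ hxb
      have h1 := hleaf b hb _ hxb
      have h2 : x = b := by rw [← hg.1 x, h1, hgb]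
      exact hx (by rw [h2, hgb])
    · rw [unmatched_joinPair hab]
      intro x hx
      have := disjoint_left.1 hAB (mem_of_mem_erase hx)
      have := hAu (mem_of_mem_erase hx)
      grind
    · rw [unmatched_joinPair hab]
      intro x hx
      have := hBu (mem_of_mem_erase hx)
      grind
    · exact hAB.mono (erase_subset _ _) (erase_subset _ _)
    · exact fun b' hb' => hleaf b' (mem_of_mem_erase hb')
    · intro g' hg' B' hB' hcard hu
      refine h g' hg' (insert b B') ?_ ?_ ?_
      · exact insert_subset hb (hB'.trans (erase_subset _ _))
      · rw [card_insert_of_notMem (fun h => by simpa using hB' h), hcard]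
      · rw [hu, unmatched_joinPair hab]
        ext x
        simp only [mem_sdiff, mem_union, mem_insert, mem_erase, mem_singleton]
        grind

lemma one_le_simpleExtensions_of_unmatched_eq_empty {v : X → V} {g : X → X}
    (hg : IsPartialSimple v g) (hu : unmatched g = ∅) : 1 ≤ #(simpleExtensions v g) := by
  refine card_pos.2 ⟨g, mem_simpleExtensions.2 ⟨hg, fun x hx => ?_, fun _ _ => rfl⟩⟩
  simpa [hu] using mem_unmatched.2 hx

/-- If at least half of the unmatched half-edges belong to leaves, the matching can be completed. -/
lemma one_le_simpleExtensions {v : X → V} {g : X → X} (hg : IsPartialSimple v g) {B : Finset X}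
    (hB : B ⊆ unmatched g) (hleaf : ∀ b ∈ B, ∀ x, v x = v b → x = b) {k : ℕ}
    (hk : #(unmatched g) = 2 * k) (hkB : k ≤ #B) : 1 ≤ #(simpleExtensions v g) := by
  obtain ⟨B₀, hB₀, hcard⟩ := exists_subset_card_eq hkB
  have hA : #(unmatched g \ B₀) = k := by
    rw [card_sdiff_of_subset (hB₀.trans hB)]; omega
  have := descFactorial_mul_le_simpleExtensions (v := v) (m := 1) k g (unmatched g \ B₀) B₀ hA hg
    sdiff_subset (hB₀.trans hB) sdiff_disjoint (fun b hb => hleaf b (hB₀ hb)) ?_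
  · refine le_trans ?_ this
    rw [hcard, Nat.descFactorial_self, mul_one]
    exact Nat.factorial_pos k
  · intro g' hg' B' hB' hc hu
    refine one_le_simpleExtensions_of_unmatched_eq_empty hg' ?_
    rw [eq_of_subset_of_card_le hB' (by omega)] at hu
    rw [hu, sdiff_union_of_subset (hB₀.trans hB), sdiff_eq_empty_iff_subset]

/-- Greedy matching when every unmatched half-edge belongs to a vertex of degree at most `K`. -/
lemma doubleFactorial_le_simpleExtensions {v : X → V} {K c : ℕ} (hc : c = K + K * K)
    (R : Finset X) (hR : #R = c) (hleaf : ∀ b ∈ R, ∀ x, v x = v b → x = b) (j : ℕ) :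
    ∀ g : X → X, IsPartialSimple v g → R ⊆ unmatched g → #(unmatched g) = 2 * c + 2 * j →
      (∀ x ∈ unmatched g, #(univ.filter fun y => v y = v x) ≤ K) →
      (2 * j).doubleFactorial ≤ #(simpleExtensions v g) := by
  induction j with
  | zero =>
    intro g hg hRu hu _
    exact one_le_simpleExtensions hg hRu hleaf (k := c) (by omega) hR.ge
  | succ j ih =>
    intro g hg hRu hu hK
    have hfree : #(unmatched g \ R) = c + 2 * (j + 1) := by
      rw [card_sdiff_of_subset hRu]; omega
    obtain ⟨a, ha⟩ : (unmatched g \ R).Nonempty := card_pos.1 (by omega)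
    obtain ⟨hau, haR⟩ := mem_sdiff.1 ha
    have hga := mem_unmatched.1 hau
    set N := univ.filter fun y => v y = v a with hN
    set F := N ∪ N.biUnion fun x =>
      (unmatched g).filter fun y => v y = v (g x) with hF
    have hFc : #F ≤ c := by
      have h1 : #N ≤ K := hK a hau
      have h2 : #(N.biUnion fun x => (unmatched g).filter fun y => v y = v (g x)) ≤ #N * K := by
        refine card_biUnion_le_card_mul _ _ _ fun x _ => ?_
        rcases ((unmatched g).filter fun y => v y = v (g x)).eq_empty_or_nonempty with h | ⟨z, hz⟩
        · simp [h]
        · obtain ⟨hz1, hz2⟩ := mem_filter.1 hz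
          refine le_trans (card_le_card fun y hy => ?_) (hK z hz1)
          rw [mem_filter] at hy ⊢
          exact ⟨mem_univ _, hy.2.trans hz2.symm⟩
      have h3 := Nat.mul_le_mul_right K h1
      have := card_union_le N
        (N.biUnion fun x => (unmatched g).filter fun y => v y = v (g x))
      rw [← hF] at this
      omega
    set B := (unmatched g \ R) \ F with hBdef
    have hBc : 2 * (j + 1) ≤ #B := by
      have := le_card_sdiff F (unmatched g \ R)
      rw [← hBdef] at this
      omega
    have hB : ∀ b ∈ B, b ∈ unmatched g ∧ b ∉ R ∧ v b ≠ v a ∧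
        ∀ x, v x = v a → v (g x) ≠ v b := by
      intro b hb
      obtain ⟨hb1, hb2⟩ := mem_sdiff.1 hb
      obtain ⟨hb3, hb4⟩ := mem_sdiff.1 hb1
      refine ⟨hb3, hb4, fun h => hb2 ?_, fun x hx h => hb2 ?_⟩
      · exact mem_union_left _ (mem_filter.2 ⟨mem_univ _, h⟩)
      · exact mem_union_right _ (mem_biUnion.2
          ⟨x, mem_filter.2 ⟨mem_univ _, hx⟩, mem_filter.2 ⟨hb3, h.symm⟩⟩)
    have haB : a ∉ B := fun h => (hB a h).2.2.1 rfl
    refine le_trans ?_ (card_mul_le_simpleExtensions (v := v) (m := (2 * j).doubleFactorial)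
      hga haB (fun b hb => (hB b hb).1) ?_)
    · rw [show 2 * (j + 1) = 2 * j + 2 by ring, Nat.doubleFactorial_add_two]
      exact Nat.mul_le_mul_right _ hBc
    · intro b hb
      obtain ⟨hbu, hbR, hbv, hbadj⟩ := hB b hb
      have hab : a ≠ b := fun h => hbv (by rw [h])
      have hsub : {a, b} ⊆ unmatched g := by
        intro x hx
        rcases mem_insert.1 hx with rfl | hx
        · exact hau
        · exact mem_singleton.1 hx ▸ hbu
      refine ih _ (isPartialSimple_joinPair hg hga (mem_unmatched.1 hbu) hbv
        fun x _ => hbadj x) ?_ ?_ ?_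
      · rw [unmatched_joinPair hab]
        intro x hx
        have := hRu hx
        simp only [mem_sdiff, mem_insert, mem_singleton]
        grind
      · rw [unmatched_joinPair hab, card_sdiff_of_subset hsub, card_pair hab]
        omega
      · intro x hx
        rw [unmatched_joinPair hab] at hx
        exact hK x (mem_sdiff.1 hx).1

/-- The number of perfect matchings extending a partial matching. -/
lemma card_extensions_le (n : ℕ) : ∀ g : X → X, Function.Involutive g → #(unmatched g) = n →
    #(extensions g) ≤ (n - 1).doubleFactorial := by
  induction n using Nat.strong_induction_on with
  | _ n ih =>
    intro g hg hn
    rcases Nat.eq_zero_or_pos n with rfl | hpos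
    · have hu := card_eq_zero.1 hn
      refine card_le_one.2 fun f hf f' hf' => funext fun x => ?_
      have hx : g x ≠ x := fun h => by simpa [hu] using mem_unmatched.2 h
      rw [(mem_extensions.1 hf).2.2 x hx, (mem_extensions.1 hf').2.2 x hx]
    obtain ⟨a, hau⟩ : (unmatched g).Nonempty := card_pos.1 (by omega)
    have ha := mem_unmatched.1 hau
    have hsub : extensions g ⊆ ((unmatched g).erase a).biUnion fun b =>
        extensions (joinPair g a b) := by
      intro f hf
      obtain ⟨h1, h2, h3⟩ := mem_extensions.1 hf
      have hfa : g (f a) = f a := by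
        by_contra h
        have h4 := h3 _ h
        rw [h1 a] at h4
        exact h2 a (by rw [← hg (f a), ← h4, ha])
      refine mem_biUnion.2 ⟨f a, mem_erase.2 ⟨h2 a, mem_unmatched.2 hfa⟩, ?_⟩
      refine mem_extensions.2 ⟨h1, h2, fun x => ?_⟩
      have h5 := h3 x
      have h6 := h1 a
      unfold joinPair
      grind
    have hcard : #((unmatched g).erase a) = n - 1 := by rw [card_erase_of_mem hau, hn]
    have hmul : #(extensions g) ≤ (n - 1) * (n - 2 - 1).doubleFactorial := by
      refine (card_le_card hsub).trans (hcard ▸ card_biUnion_le_card_mul _ _ _ fun b hb => ?_)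
      obtain ⟨hba, hbu⟩ := mem_erase.1 hb
      refine ih (n - 2) (by omega) _ (joinPair_involutive hg ha (mem_unmatched.1 hbu)) ?_
      rw [unmatched_joinPair hba.symm, card_sdiff_of_subset, card_pair hba.symm, hn]
      intro x hx
      rcases mem_insert.1 hx with rfl | hx
      · exact hau
      · exact mem_singleton.1 hx ▸ hbu
    refine hmul.trans ?_
    rcases n with _ | _ | _ | n
    · simp
    · simp
    · simp
    · exact (Nat.doubleFactorial_add_two n).ge

/-- A lower bound for the number of simple perfect matchings: match the half-edges at vertices of
degree more than `K` to leaves, then match greedily. -/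
lemma mul_doubleFactorial_le_simpleExtensions {v : X → V} {K c j : ℕ} (hc : c = K + K * K)
    (hK1 : 1 ≤ K) {deg : X → ℕ} (hdeg : ∀ x, #(univ.filter fun y => v y = v x) = deg x)
    {A B : Finset X} (hA : A = univ.filter fun x => K < deg x)
    (hB : B = univ.filter fun x => deg x = 1)
    (hcard : Fintype.card X = 2 * #A + 2 * c + 2 * j) (hAB : #A + c ≤ #B) :
    (#B).descFactorial #A * (2 * j).doubleFactorial ≤ #(simpleExtensions v (id : X → X)) := by
  have hid : unmatched (id : X → X) = univ := by ext; simp [unmatched]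
  have hdisj : Disjoint A B := by
    refine disjoint_left.2 fun x hx hx' => ?_
    subst hA hB
    have h1 := (mem_filter.1 hx).2
    have h2 := (mem_filter.1 hx').2
    omega
  have hleaf : ∀ b ∈ B, ∀ x, v x = v b → x = b := by
    intro b hb x hx
    subst hB
    obtain ⟨z, hz⟩ := card_eq_one.1 ((hdeg b).trans (mem_filter.1 hb).2)
    have h1 : x ∈ ({z} : Finset X) := hz ▸ mem_filter.2 ⟨mem_univ _, hx⟩
    have h2 : b ∈ ({z} : Finset X) := hz ▸ mem_filter.2 ⟨mem_univ _, rfl⟩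
    rw [mem_singleton.1 h1, mem_singleton.1 h2]
  refine descFactorial_mul_le_simpleExtensions _ id A B rfl ?_ (by simp [hid]) (by simp [hid])
    hdisj hleaf ?_
  · exact ⟨fun _ => rfl, fun x h => absurd rfl h, fun x _ h => absurd rfl h⟩
  · intro g hg B' hB' hcB' hu
    rw [hid] at hu
    obtain ⟨R, hR, hRc⟩ : ∃ R ⊆ B \ B', #R = c := exists_subset_card_eq (by
      rw [card_sdiff_of_subset hB']; omega)
    refine doubleFactorial_le_simpleExtensions hc R hRc
      (fun b hb => hleaf b (mem_sdiff.1 (hR hb)).1) j g hg ?_ ?_ ?_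
    · intro x hx
      obtain ⟨h1, h2⟩ := mem_sdiff.1 (hR hx)
      have := disjoint_right.1 hdisj h1
      rw [hu]
      simp [h2, this]
    · rw [hu, card_sdiff_of_subset (subset_univ _), card_union_of_disjoint
        (hdisj.mono_right hB'), card_univ]
      omega
    · intro x hx
      by_contra h
      rw [hu] at hx
      rw [hdeg] at h
      refine (mem_sdiff.1 hx).2 (mem_union_left _ ?_)
      rw [hA]
      exact mem_filter.2 ⟨mem_univ _, by omega⟩

end PartialMatchings

lemma doubleFactorial_le_pow_mul (k j : ℕ) :
    (2 * (k + j) - 1).doubleFactorial ≤ (2 * (k + j)) ^ k * (2 * j).doubleFactorial := by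
  induction k with
  | zero =>
    rcases j with _ | j
    · simp
    · have h : ∀ n : ℕ, n.doubleFactorial ≤ (n + 1).doubleFactorial := by
        intro n
        induction n using Nat.twoStepInduction with
        | zero => simp
        | one => simp
        | more n ih _ =>
          rw [Nat.doubleFactorial_add_two, show n + 2 + 1 = (n + 1) + 2 by ring,
            Nat.doubleFactorial_add_two]
          exact Nat.mul_le_mul (by omega) ih
      rw [add_comm 0 (j + 1), pow_zero, one_mul]
      exact h (2 * j + 1)
  | succ k ih =>
    rcases Nat.eq_zero_or_pos (k + j) with h | h
    · obtain ⟨rfl, rfl⟩ : k = 0 ∧ j = 0 := by omega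
      simp
    · rw [show 2 * (k + 1 + j) - 1 = (2 * (k + j) - 1) + 2 by omega, Nat.doubleFactorial_add_two,
        pow_succ', mul_assoc]
      refine Nat.mul_le_mul (by omega) (ih.trans (Nat.mul_le_mul_right _ ?_))
      exact Nat.pow_le_pow_left (by omega) k

section Counting

open Finset

lemma numV_eq_sum_range {m : ℕ →₀ ℕ} {N : ℕ} (hN : m.support ⊆ range N) :
    numV m = ∑ k ∈ range N, m k :=
  Finsupp.sum_of_support_subset _ hN _ (by simp)

lemma sum_Icc_le_numV (m : ℕ →₀ ℕ) (j : ℕ) : ∑ k ∈ Icc 1 j, m k ≤ numV m := by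
  rw [numV_eq_sum_range (N := max (j + 1) (m.support.sup id + 1)) (fun i hi => by
    have := le_sup (f := id) hi
    simp only [id] at this
    simp
    omega)]
  refine sum_le_sum_of_subset fun i hi => ?_
  simp only [mem_Icc, mem_range] at hi ⊢
  omega

lemma exists_lt_sum_Icc {m : ℕ →₀ ℕ} (h0 : m 0 = 0) {i : ℕ} (hi : i < numV m) :
    ∃ j, i < ∑ k ∈ Icc 1 j, m k := by
  refine ⟨m.support.sup id, hi.trans_le ?_⟩
  refine sum_le_sum_of_ne_zero (f := m) fun x hx hx0 => ?_
  have := le_sup (f := id) hx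
  simp only [id] at this
  exact mem_Icc.2 ⟨Nat.pos_of_ne_zero fun h => hx0 (h ▸ h0), this⟩

lemma lt_sum_Icc_iff_degOf_le {m : ℕ →₀ ℕ} (h0 : m 0 = 0) {i : ℕ} (hi : i < numV m) (j : ℕ) :
    i < ∑ k ∈ Icc 1 j, m k ↔ degOf m i ≤ j := by
  constructor
  · intro h
    exact Nat.sInf_le h
  · intro h
    have h1 : i < ∑ k ∈ Icc 1 (degOf m i), m k := Nat.sInf_mem (exists_lt_sum_Icc h0 hi)
    exact h1.trans_le (sum_le_sum_of_subset (Icc_subset_Icc_right h))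

lemma card_degOf_le {m : ℕ →₀ ℕ} (h0 : m 0 = 0) (j : ℕ) :
    #(univ.filter fun v : Fin (numV m) => degOf m v ≤ j) = ∑ k ∈ Icc 1 j, m k := by
  have h : (univ.filter fun v : Fin (numV m) => degOf m v ≤ j)
      = univ.filter fun v : Fin (numV m) => (v : ℕ) < ∑ k ∈ Icc 1 j, m k :=
    filter_congr fun v _ => (lt_sum_Icc_iff_degOf_le h0 v.2 j).symm
  rw [h, Fin.card_filter_val_lt, min_eq_right (sum_Icc_le_numV m j)]

lemma card_degOf_eq {m : ℕ →₀ ℕ} (h0 : m 0 = 0) (j : ℕ) :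
    #(univ.filter fun v : Fin (numV m) => degOf m v = j) = m j := by
  rcases j with _ | j
  · have h := card_degOf_le h0 0
    simpa [h0] using h
  · have h1 := card_degOf_le h0 j
    have h2 := card_degOf_le h0 (j + 1)
    rw [sum_Icc_succ_top (by omega), ← h1] at h2
    have h3 : (univ.filter fun v : Fin (numV m) => degOf m v ≤ j + 1)
        = (univ.filter fun v : Fin (numV m) => degOf m v ≤ j) ∪
          univ.filter fun v : Fin (numV m) => degOf m v = j + 1 := by
      ext v
      simp only [mem_filter, mem_univ, true_and, mem_union]
      omega
    rw [h3, card_union_of_disjoint] at h2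
    · omega
    · refine disjoint_filter.2 fun v _ h => ?_
      omega

lemma card_halfEdges_filter (m : ℕ →₀ ℕ) (P : ℕ → Prop) [DecidablePred P] :
    #(univ.filter fun x : HalfEdges m => P (degOf m x.1)) =
      ∑ v : Fin (numV m), if P (degOf m v) then degOf m v else 0 := by
  rw [card_filter, Fintype.sum_sigma]
  refine sum_congr rfl fun v _ => ?_
  split_ifs <;> simp

lemma card_fiber (m : ℕ →₀ ℕ) (x : HalfEdges m) :
    #(univ.filter fun y : HalfEdges m => y.1 = x.1) = degOf m x.1 := by
  rw [card_filter, Fintype.sum_sigma, Fintype.sum_eq_single x.1]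
  · simp
  · intro v hv
    simp [hv]

lemma card_halfEdges_eq {m : ℕ →₀ ℕ} (h0 : m 0 = 0) (i : ℕ) :
    #(univ.filter fun x : HalfEdges m => degOf m x.1 = i) = i * m i := by
  rw [card_halfEdges_filter m (· = i), ← card_degOf_eq h0 i, card_filter, mul_sum]
  refine sum_congr rfl fun v _ => ?_
  split_ifs with h <;> simp [h]

lemma card_halfEdges {m : ℕ →₀ ℕ} (h0 : m 0 = 0) :
    Fintype.card (HalfEdges m) = totalDeg m := by
  have hmaps : ∀ x ∈ (univ : Finset (HalfEdges m)), degOf m x.1 ∈ m.support := by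
    intro x _
    rw [Finsupp.mem_support_iff, ← card_degOf_eq h0]
    exact (card_pos.2 ⟨x.1, by simp⟩).ne'
  rw [← card_univ, card_eq_sum_card_fiberwise hmaps, totalDeg, Finsupp.sum]
  exact sum_congr rfl fun i _ => card_halfEdges_eq h0 i

lemma card_halfEdges_le {m : ℕ →₀ ℕ} (h0 : m 0 = 0) (K : ℕ) :
    #(univ.filter fun x : HalfEdges m => degOf m x.1 ≤ K) = ∑ i ∈ range (K + 1), i * m i := by
  rw [card_eq_sum_card_fiberwise (f := fun x : HalfEdges m => degOf m x.1) (t := range (K + 1))]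
  · refine sum_congr rfl fun i hi => ?_
    rw [← card_halfEdges_eq h0 i, filter_filter]
    congr 1
    refine filter_congr fun x _ => ?_
    have := mem_range.1 hi
    constructor
    · exact fun h => h.2
    · intro h
      exact ⟨by omega, h⟩
  · intro x hx
    have := (mem_filter.1 hx).2
    simp only [coe_range, Set.mem_Iio]
    omega

lemma card_halfEdges_gt {m : ℕ →₀ ℕ} (h0 : m 0 = 0) (K : ℕ) :
    #(univ.filter fun x : HalfEdges m => K < degOf m x.1) + ∑ i ∈ range (K + 1), i * m i
      = totalDeg m := by
  rw [← card_halfEdges_le h0, ← card_halfEdges h0, ← card_univ,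
    ← card_filter_add_card_filter_not (s := univ) (fun x : HalfEdges m => K < degOf m x.1)]
  simp only [not_lt]

lemma cS_eq_card_simpleExtensions (m : ℕ →₀ ℕ) :
    cS m = #(simpleExtensions (Sigma.fst : HalfEdges m → _) id) := by
  rw [cS, ← Set.ncard_coe_finset]
  congr 1
  ext f
  rw [mem_coe, mem_simpleExtensions]
  constructor
  · rintro ⟨⟨h1, h2⟩, h3, h4⟩
    refine ⟨⟨h1, fun x _ => h3 x, fun x y _ _ hv hv' => (h4 x y hv hv').resolve_right ?_⟩, h2, fun x hx => absurd rfl hx⟩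
    rintro rfl
    exact h3 y hv
  · rintro ⟨⟨h1, h3, h4⟩, h2, -⟩
    exact ⟨⟨h1, h2⟩, fun x => h3 x (h2 x), fun x y hv hv' => Or.inl (h4 x y (h2 x) (h2 y) hv hv')⟩

lemma cS_le_doubleFactorial {m : ℕ →₀ ℕ} (h0 : m 0 = 0) :
    cS m ≤ (totalDeg m - 1).doubleFactorial := by
  have hu : #(unmatched (id : HalfEdges m → HalfEdges m)) = totalDeg m := by
    rw [← card_halfEdges h0, ← card_univ]
    congr 1
    ext
    simp [mem_unmatched]
  rw [cS_eq_card_simpleExtensions]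
  refine (card_le_card fun f hf => ?_).trans
    (card_extensions_le (totalDeg m) (id : HalfEdges m → HalfEdges m) (fun _ => rfl) hu)
  obtain ⟨h1, h2⟩ := mem_simpleExtensions.1 hf
  exact mem_extensions.2 ⟨h1.1, h2⟩

/-- `h` is the number of half-edges at vertices of degree more than `K`. -/
lemma doubleFactorial_mul_le_cS {m : ℕ →₀ ℕ} (h0 : m 0 = 0) (heven : Even (totalDeg m))
    {K h : ℕ} (hK : 1 ≤ K) (hh : h + ∑ i ∈ range (K + 1), i * m i = totalDeg m)
    (hm : h + 2 * (K + K * K) ≤ m 1) :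
    (totalDeg m - 1).doubleFactorial * (m 1 - h) ^ h ≤
      totalDeg m ^ (h + (K + K * K)) * cS m := by
  set c := K + K * K with hc
  have hm1 : m 1 ≤ ∑ i ∈ range (K + 1), i * m i := by
    have := single_le_sum (f := fun i => i * m i) (fun _ _ => Nat.zero_le _)
      (show 1 ∈ range (K + 1) by simp; omega)
    simpa using this
  obtain ⟨t, ht⟩ := heven
  obtain ⟨j, rfl⟩ : ∃ j, t = h + c + j := ⟨t - (h + c), by omega⟩
  have hA : #(univ.filter fun x : HalfEdges m => K < degOf m x.1) = h := by
    have := card_halfEdges_gt h0 K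
    omega
  have hB : #(univ.filter fun x : HalfEdges m => degOf m x.1 = 1) = m 1 := by
    rw [card_halfEdges_eq h0, one_mul]
  have key := mul_doubleFactorial_le_simpleExtensions (v := (Sigma.fst : HalfEdges m → _))
    (j := j) hc hK (deg := fun x => degOf m x.1) (fun x => by convert card_fiber m x) rfl rfl
  simp only [hA, hB, card_halfEdges h0] at key
  replace key := key (by omega) (by omega)
  rw [← cS_eq_card_simpleExtensions] at key
  have hd := doubleFactorial_le_pow_mul (h + c) j
  rw [show 2 * (h + c + j) = totalDeg m by omega] at hd
  have hp : (m 1 - h) ^ h ≤ (m 1).descFactorial h :=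
    (Nat.pow_le_pow_left (by omega) h).trans (Nat.pow_sub_le_descFactorial _ _)
  calc _ ≤ (totalDeg m ^ (h + c) * (2 * j).doubleFactorial) * (m 1).descFactorial h :=
        Nat.mul_le_mul hd hp
    _ = totalDeg m ^ (h + c) * ((m 1).descFactorial h * (2 * j).doubleFactorial) := by ring
    _ ≤ _ := Nat.mul_le_mul_left _ key

lemma typeOf_zero {d : (n : ℕ) → Fin n → ℕ} (hdpos : ∀ n j, 0 < d n j) (n : ℕ) :
    typeOf d n 0 = 0 := by
  simp [typeOf, Finsupp.finsetSum_apply, (hdpos n _).ne']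

lemma totalDeg_typeOf (d : (n : ℕ) → Fin n → ℕ) (n : ℕ) :
    totalDeg (typeOf d n) = ℓTot d n := by
  rw [totalDeg, typeOf, ℓTot, ← Finsupp.sum_finsetSum_index]
  · simp
  · simp
  · intro i a b
    ring

end Counting

/-- Proposition 2.1 of the paper: under Conditions (a), (b) and `p₁ > 0`,
the number of configurations is `e^{o(n)}` times the number of simple configurations:
`(1/n)·log((ℓ_n−1)!!/|𝒮_{n(n)}|) → 0`. -/
theorem configurations_vs_simple_graphs
    (d : (n : ℕ) → Fin n → ℕ) (p : ℕ → ℝ)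
    (hdpos : ∀ n j, 0 < d n j) (hdeven : ∀ n, Even (ℓTot d n))
    (hp0 : p 0 = 0) (hpnn : ∀ i, 0 ≤ p i) (hpsum : ∑' i : ℕ, p i = 1)
    (ha : ∀ i : ℕ, Filter.Tendsto (fun n : ℕ => (typeOf d n i : ℝ) / (n : ℝ))
      Filter.atTop (nhds (p i)))
    (hmom : Summable fun i : ℕ => (i : ℝ) * p i)
    (hb : Filter.Tendsto (fun n : ℕ => (ℓTot d n : ℝ) / (n : ℝ)) Filter.atTop
      (nhds (∑' i : ℕ, (i : ℝ) * p i)))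
    (hp1 : 0 < p 1) :
    Filter.Tendsto (fun n : ℕ =>
        (1 / (n : ℝ)) * Real.log
          ((Nat.doubleFactorial (ℓTot d n - 1) : ℝ) / (cS (typeOf d n) : ℝ)))
      Filter.atTop (nhds 0) := by
  have hlow : ∀ n : ℕ, 0 ≤ (1 / (n : ℝ)) * Real.log
      ((Nat.doubleFactorial (ℓTot d n - 1) : ℝ) / (cS (typeOf d n) : ℝ)) := by
    intro n
    refine mul_nonneg (by positivity) ?_
    rcases Nat.eq_zero_or_pos (cS (typeOf d n)) with h | h
    · simp [h]
    · refine Real.log_nonneg ((one_le_div (by exact_mod_cast h)).2 ?_)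
      rw [← totalDeg_typeOf]
      exact_mod_cast cS_le_doubleFactorial (typeOf_zero hdpos n)
  refine tendsto_order.2 ⟨fun a h0 => Filter.Eventually.of_forall fun n => h0.trans_le (hlow n),
    fun δ hδ => ?_⟩
  set μ := ∑' i : ℕ, (i : ℝ) * p i with hμ
  have hμ0 : 0 ≤ μ := tsum_nonneg fun i => mul_nonneg (Nat.cast_nonneg i) (hpnn i)
  set M := μ + 1 with hM
  have hM0 : 0 < M := by linarith
  set C := |Real.log (2 * M / p 1)| with hC
  have hC0 : 0 ≤ C := abs_nonneg _
  obtain ⟨ε, hε0, hε1, hε2⟩ : ∃ ε : ℝ, 0 < ε ∧ ε ≤ p 1 / 4 ∧ ε * C ≤ δ / 2 := by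
    refine ⟨min (p 1 / 4) (δ / (2 * (C + 1))), by positivity, min_le_left _ _, ?_⟩
    calc _ ≤ δ / (2 * (C + 1)) * (C + 1) :=
          mul_le_mul (min_le_right _ _) (by linarith) hC0 (by positivity)
      _ = δ / 2 := by field_simp
  obtain ⟨K, hK1, hK⟩ : ∃ K : ℕ, 1 ≤ K ∧ μ - ∑ i ∈ Finset.range (K + 1), (i : ℝ) * p i < ε := by
    have h1 := (Filter.tendsto_add_atTop_iff_nat 1).2 hmom.hasSum.tendsto_sum_nat
    have h2 := (h1.eventually (lt_mem_nhds (show μ - ε < μ by linarith))).and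
      (Filter.eventually_ge_atTop 1)
    obtain ⟨K, hK, hK1⟩ := h2.exists
    exact ⟨K, hK1, by linarith⟩
  set c := K + K * K with hc
  have hhigh : ∀ᶠ n : ℕ in Filter.atTop,
      (ℓTot d n : ℝ) / n - ∑ i ∈ Finset.range (K + 1), (i : ℝ) * ((typeOf d n i : ℝ) / n) < ε :=
    (hb.sub (tendsto_finsetSum _ fun i _ => (ha i).const_mul (i : ℝ))).eventually
      (gt_mem_nhds hK)
  have hlog : ∀ᶠ n : ℕ in Filter.atTop, (c : ℝ) * Real.log (M * n) < δ / 2 * n := by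
    have h1 : Filter.Tendsto (fun n : ℕ => Real.log (M * n) ^ 1 / (1 * (M * n) + 0))
        Filter.atTop (nhds 0) :=
      (Real.tendsto_pow_log_div_mul_add_atTop 1 0 1 one_ne_zero).comp
        (tendsto_natCast_atTop_atTop.const_mul_atTop hM0)
    have h2 := h1.const_mul (c * M)
    rw [mul_zero] at h2
    filter_upwards [h2.eventually (gt_mem_nhds (half_pos hδ)), Filter.eventually_gt_atTop 0]
      with n hn hn0
    have hn0' : (0 : ℝ) < n := by exact_mod_cast hn0
    rw [← div_lt_iff₀ hn0']
    convert hn using 1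
    field_simp
    ring
  have hleaf := (ha 1).eventually (lt_mem_nhds (show 3 * p 1 / 4 < p 1 by linarith))
  have hdeg := hb.eventually (gt_mem_nhds (show μ < M by linarith))
  have hlarge := (tendsto_natCast_atTop_atTop (R := ℝ)).eventually_ge_atTop (2 * c / (p 1 / 2))
  filter_upwards [hhigh, hlog, hleaf, hdeg, hlarge, Filter.eventually_gt_atTop 0]
    with n hn1 hn2 hn3 hn4 hn5 hn0
  have hn : (0 : ℝ) < n := by exact_mod_cast hn0
  have h0 := typeOf_zero hdpos n
  have htot := totalDeg_typeOf d n
  set m := typeOf d n with hm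
  obtain ⟨h, hh⟩ : ∃ h, h + ∑ i ∈ Finset.range (K + 1), i * m i = totalDeg m :=
    ⟨_, card_halfEdges_gt h0 K⟩
  have hhε : (h : ℝ) < ε * n := by
    rw [← div_lt_iff₀ hn]
    refine lt_of_eq_of_lt ?_ hn1
    have : (h : ℝ) + ∑ i ∈ Finset.range (K + 1), (i : ℝ) * m i = ℓTot d n := by
      rw [← htot]
      exact_mod_cast hh
    simp only [← mul_div_assoc]
    rw [← this, ← Finset.sum_div]
    ring
  rw [lt_div_iff₀ hn] at hn3
  rw [div_lt_iff₀ hn] at hn4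
  rw [div_le_iff₀ (by positivity)] at hn5
  set q := p 1 / 2 * n with hq
  have hq0 : 0 < q := by positivity
  have hqm : q ≤ (m 1 : ℝ) - h := by
    have := mul_le_mul_of_nonneg_right hε1 hn.le
    rw [hq]
    linarith
  have hm1 : h + 2 * c ≤ m 1 := by
    have : (h : ℝ) + 2 * c ≤ m 1 := by linarith
    exact_mod_cast this
  have key := doubleFactorial_mul_le_cS h0 (htot ▸ hdeven n) hK1 hh hm1
  rw [htot] at key
  set x := (ℓTot d n - 1).doubleFactorial with hx
  have hx0 : (0 : ℝ) < x := by exact_mod_cast Nat.doubleFactorial_pos _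
  have key' : (x : ℝ) * q ^ h ≤ (M * n) ^ (h + c) * cS m := by
    have h1 : (x : ℝ) * ((m 1 : ℝ) - h) ^ h ≤ (ℓTot d n : ℝ) ^ (h + c) * cS m := by
      rw [← Nat.cast_sub (by omega)]
      exact_mod_cast key
    calc _ ≤ (x : ℝ) * ((m 1 : ℝ) - h) ^ h := by gcongr
      _ ≤ _ := h1
      _ ≤ _ := by gcongr
  have hS : (0 : ℝ) < cS m := by
    have h1 : 0 < (x : ℝ) * q ^ h := by positivity
    exact pos_of_mul_pos_right (h1.trans_le key') (by positivity)
  have hratio : (x : ℝ) / cS m ≤ (M * n) ^ (h + c) / q ^ h := by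
    rw [div_le_div_iff₀ hS (by positivity)]
    exact key'
  have hlogle : Real.log ((x : ℝ) / cS m) ≤
      h * Real.log (2 * M / p 1) + c * Real.log (M * n) := by
    refine (Real.log_le_log (by positivity) hratio).trans (le_of_eq ?_)
    have h1 : 2 * M / p 1 = (M * n) / q := by
      rw [hq]
      field_simp
    rw [h1, Real.log_div (by positivity) (by positivity), Real.log_div (by positivity)
      (by positivity), Real.log_pow, Real.log_pow]
    push_cast
    ring
  rw [one_div, inv_mul_lt_iff₀ hn]
  calc Real.log ((x : ℝ) / cS m) ≤ h * Real.log (2 * M / p 1) + c * Real.log (M * n) := hlogle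
    _ ≤ ε * n * C + c * Real.log (M * n) := by
        have := mul_le_mul hhε.le (le_refl C) hC0 (by positivity)
        have h2 := mul_le_mul_of_nonneg_left (le_abs_self (Real.log (2 * M / p 1)))
          (Nat.cast_nonneg (α := ℝ) h)
        linarith
    _ < δ / 2 * n + δ / 2 * n := by
        have := mul_le_mul_of_nonneg_right hε2 hn.le
        nlinarith
    _ = n * δ := by ring

end PaperCM
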